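/- arXiv:2011.00520 — 2 statements merged into one kernel-verified Lean document; each statement's English description precedes it below -/
import Mathlib

section
/- Let T be an n×n row-stochastic matrix, x₀ ∈ ℝⁿ, μ ∈ ℝ, and suppose the mean-field hypothesis holds for (T, x₀, μ): for every i and every k ∈ ℕ, Σ_{j≠i} T_{ij} (T_{jj})^k (x_{j,0} − μ) = 0. Define x_t = T^t x₀. Then for every agent i and every t ≥ 1, x_{i,t} − x_{i,t−1} = (T_{ii})^{t−1} (1 − T_{ii}) (μ − x_{i,0}). Consequently, if 0 ≤ T_{ii} ≤ 1 then the sign of x_{i,t} − x_{i,t−1} is the same for all t ≥ 1, so each agent's belief sequence (x_{i,t})_{t≥0} is monotone, moving weakly toward μ. -/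
/-- Under the mean-field hypothesis, the deviation of agent `i`'s belief from `μ` is scaled by
`T i i` at every step. -/
theorem pow_mulVec_eq_of_mean_field {ι : Type*} [Fintype ι] [DecidableEq ι]
    (T : Matrix ι ι ℝ) (hrow : ∀ i, ∑ j, T i j = 1) (x₀ : ι → ℝ) (μ : ℝ)
    (hmf : ∀ i : ι, ∀ k : ℕ,
      ∑ j ∈ Finset.univ.filter (fun j => j ≠ i), T i j * (T j j) ^ k * (x₀ j - μ) = 0)
    (t : ℕ) (i : ι) :
    ((T ^ t).mulVec x₀) i = μ + (T i i) ^ t * (x₀ i - μ) := by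
  induction t generalizing i with
  | zero => simp
  | succ t ih =>
    have hsplit : ∑ j, T i j * (T j j) ^ t * (x₀ j - μ) = T i i * (T i i) ^ t * (x₀ i - μ) := by
      rw [← Finset.add_sum_erase _ _ (Finset.mem_univ i), ← Finset.filter_ne', hmf, add_zero]
    calc ((T ^ (t + 1)).mulVec x₀) i
        = ∑ j, T i j * ((T ^ t).mulVec x₀) j := by
          rw [pow_succ', ← Matrix.mulVec_mulVec]; rfl
      _ = ∑ j, (T i j * μ + T i j * (T j j) ^ t * (x₀ j - μ)) :=
          Finset.sum_congr rfl fun j _ => by rw [ih]; ring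
      _ = μ + (T i i) ^ (t + 1) * (x₀ i - μ) := by
          rw [Finset.sum_add_distrib, ← Finset.sum_mul, hrow, hsplit]; ring

/-- Under the mean-field hypothesis, each agent's belief changes by
`x_{i,t} - x_{i,t-1} = (T i i)^(t-1) (1 - T i i) (μ - x_{i,0})` at every `t ≥ 1`;
consequently (when `0 ≤ T i i ≤ 1`) each agent's belief sequence is monotone,
moving weakly toward `μ`. -/
theorem beliefs_monotone_mean_field {n : ℕ}
    (T : Matrix (Fin n) (Fin n) ℝ)
    (hnonneg : ∀ i j, 0 ≤ T i j)
    (hrow : ∀ i, ∑ j, T i j = 1)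
    (x₀ : Fin n → ℝ) (μ : ℝ)
    (hmf : ∀ i : Fin n, ∀ k : ℕ,
      ∑ j ∈ Finset.univ.filter (fun j => j ≠ i), T i j * (T j j) ^ k * (x₀ j - μ) = 0) :
    (∀ (i : Fin n) (t : ℕ), 1 ≤ t →
      ((T ^ t).mulVec x₀) i - ((T ^ (t - 1)).mulVec x₀) i
        = (T i i) ^ (t - 1) * (1 - T i i) * (μ - x₀ i)) ∧
    (∀ i : Fin n, 0 ≤ T i i → T i i ≤ 1 →
      (x₀ i ≤ μ → Monotone fun t : ℕ => ((T ^ t).mulVec x₀) i) ∧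
      (μ ≤ x₀ i → Antitone fun t : ℕ => ((T ^ t).mulVec x₀) i)) := by
  have hclosed := pow_mulVec_eq_of_mean_field T hrow x₀ μ hmf
  refine ⟨fun i t ht => ?_, fun i h0 h1 => ⟨fun hx s t hst => ?_, fun hx s t hst => ?_⟩⟩
  · obtain ⟨s, rfl⟩ := Nat.exists_eq_add_of_le' ht
    rw [hclosed, hclosed, Nat.add_sub_cancel]
    ring
  · simp only [hclosed]
    nlinarith [pow_le_pow_of_le_one h0 h1 hst]
  · simp only [hclosed]
    nlinarith [pow_le_pow_of_le_one h0 h1 hst]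
end

section
/- Let T and T* be n×n real symmetric row-stochastic matrices such that T_{ii} ≥ 1/2 for every i, T*_{ij} ≤ T_{ij} for all i ≠ j, and T and T* have the same row sums. Let λ_1(·) ≥ λ_2(·) ≥ … ≥ λ_n(·) denote eigenvalues in decreasing order with multiplicity. Then all eigenvalues of both T and T* lie in [0,1], λ_1(T) = λ_1(T*) = 1, and λ_2(T*) ≥ λ_2(T). In particular, the second largest eigenvalue modulus (the largest absolute value among the eigenvalues after removing one copy of the eigenvalue 1) of T* is at least that of T. -/
/-- The eigenvalues of a real symmetric (Hermitian) matrix, listed in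
decreasing order with multiplicity: `sortedEigenvalues hA 0 ≥ sortedEigenvalues hA 1 ≥ …`. -/
noncomputable def sortedEigenvalues {n : ℕ} {A : Matrix (Fin n) (Fin n) ℝ}
    (hA : A.IsHermitian) : Fin n → ℝ :=
  fun k => (hA.eigenvalues ∘ Tuple.sort hA.eigenvalues) k.rev

open scoped Matrix

theorem sortedEigenvalues_antitone {n : ℕ} {A : Matrix (Fin n) (Fin n) ℝ}
    (hA : A.IsHermitian) : Antitone (sortedEigenvalues hA) :=
  fun _ _ h => Tuple.monotone_sort hA.eigenvalues (Fin.rev_le_rev.mpr h)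

/-- An orthonormal eigenbasis ordered compatibly with `sortedEigenvalues`. -/
noncomputable def sortedEigenvectorBasis {n : ℕ} {A : Matrix (Fin n) (Fin n) ℝ}
    (hA : A.IsHermitian) : OrthonormalBasis (Fin n) ℝ (EuclideanSpace ℝ (Fin n)) :=
  hA.eigenvectorBasis.reindex (Fin.revPerm.trans (Tuple.sort hA.eigenvalues)).symm

theorem mulVec_sortedEigenvectorBasis {n : ℕ} {A : Matrix (Fin n) (Fin n) ℝ}
    (hA : A.IsHermitian) (k : Fin n) :
    A *ᵥ (sortedEigenvectorBasis hA k).ofLp =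
      sortedEigenvalues hA k • (sortedEigenvectorBasis hA k).ofLp := by
  simpa [sortedEigenvectorBasis, sortedEigenvalues] using
    hA.mulVec_eigenvectorBasis (Tuple.sort hA.eigenvalues k.rev)

theorem hasEigenvalue_sortedEigenvalues {n : ℕ} {A : Matrix (Fin n) (Fin n) ℝ}
    (hA : A.IsHermitian) (k : Fin n) :
    Module.End.HasEigenvalue (Matrix.toLin' A) (sortedEigenvalues hA k) := by
  refine Module.End.hasEigenvalue_of_hasEigenvector
    (x := (sortedEigenvectorBasis hA k).ofLp) ⟨?_, ?_⟩
  · rw [Module.End.mem_eigenspace_iff, Matrix.toLin'_apply, mulVec_sortedEigenvectorBasis]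
  · intro h
    exact (sortedEigenvectorBasis hA).toBasis.ne_zero k (by ext i; simpa using congrFun h i)

theorem exists_sortedEigenvalues_eq {n : ℕ} {A : Matrix (Fin n) (Fin n) ℝ}
    (hA : A.IsHermitian) {μ : ℝ} (hμ : Module.End.HasEigenvalue (Matrix.toLin' A) μ) :
    ∃ k, sortedEigenvalues hA k = μ := by
  have h := hμ.mem_spectrum
  rw [Matrix.spectrum_toLin', hA.spectrum_real_eq_range_eigenvalues] at h
  obtain ⟨i, hi⟩ := h
  exact ⟨((Tuple.sort hA.eigenvalues).symm i).rev, by simp [sortedEigenvalues, hi]⟩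

theorem dotProduct_mulVec_eq_sum_sortedEigenvalues {n : ℕ} {A : Matrix (Fin n) (Fin n) ℝ}
    (hA : A.IsHermitian) (x : EuclideanSpace ℝ (Fin n)) :
    x.ofLp ⬝ᵥ A *ᵥ x.ofLp =
      ∑ k, sortedEigenvalues hA k * inner ℝ (sortedEigenvectorBasis hA k) x ^ 2 := by
  have hcoord (k : Fin n) :
      inner ℝ (sortedEigenvectorBasis hA k) (WithLp.toLp 2 (A *ᵥ x.ofLp)) =
        sortedEigenvalues hA k * inner ℝ (sortedEigenvectorBasis hA k) x := by
    rw [EuclideanSpace.inner_eq_star_dotProduct, EuclideanSpace.inner_eq_star_dotProduct]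
    simp only [star_trivial]
    rw [dotProduct_comm, Matrix.dotProduct_mulVec, ← Matrix.mulVec_transpose,
      show Aᵀ = A by simpa using hA.eq, mulVec_sortedEigenvectorBasis, smul_dotProduct,
      smul_eq_mul, dotProduct_comm]
  have h := (sortedEigenvectorBasis hA).sum_inner_mul_inner x (WithLp.toLp 2 (A *ᵥ x.ofLp))
  rw [EuclideanSpace.inner_eq_star_dotProduct] at h
  simp only [star_trivial] at h
  rw [dotProduct_comm, ← h]
  refine Finset.sum_congr rfl fun k _ => ?_
  rw [hcoord, real_inner_comm]
  ring

/-- Weyl's monotonicity principle: the sorted eigenvalues of real symmetric matrices are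
monotone with respect to the quadratic forms. -/
theorem sortedEigenvalues_mono {n : ℕ} {A B : Matrix (Fin n) (Fin n) ℝ}
    (hA : A.IsHermitian) (hB : B.IsHermitian)
    (hAB : ∀ x : Fin n → ℝ, x ⬝ᵥ A *ᵥ x ≤ x ⬝ᵥ B *ᵥ x) (k : Fin n) :
    sortedEigenvalues hA k ≤ sortedEigenvalues hB k := by
  set b := sortedEigenvectorBasis hA
  set c := sortedEigenvectorBasis hB
  let f : EuclideanSpace ℝ (Fin n) →ₗ[ℝ] ({j : Fin n // j ≠ k} → ℝ) :=
    LinearMap.pi fun j => if j.1 < k then innerₛₗ ℝ (c j) else innerₛₗ ℝ (b j)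
  have hf : LinearMap.ker f ≠ ⊥ := by
    apply LinearMap.ker_ne_bot_of_finrank_lt
    have := k.pos
    simp
    omega
  obtain ⟨x, hx, hx0⟩ := Submodule.exists_mem_ne_zero_of_ne_bot hf
  have hfx (j : Fin n) (hj : j ≠ k) : f x ⟨j, hj⟩ = 0 := congrFun hx _
  have hc (j : Fin n) (hj : j < k) : inner ℝ (c j) x = 0 := by
    simpa [f, hj] using hfx j hj.ne
  have hb (j : Fin n) (hj : k < j) : inner ℝ (b j) x = 0 := by
    simpa [f, hj.not_gt] using hfx j hj.ne'
  have hlower : sortedEigenvalues hA k * ‖x‖ ^ 2 ≤ x.ofLp ⬝ᵥ A *ᵥ x.ofLp := by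
    rw [dotProduct_mulVec_eq_sum_sortedEigenvalues hA, ← b.sum_sq_inner_right x, Finset.mul_sum]
    refine Finset.sum_le_sum fun j _ => ?_
    rcases le_or_gt j k with hj | hj
    · exact mul_le_mul_of_nonneg_right (sortedEigenvalues_antitone hA hj) (sq_nonneg _)
    · simp [b, hb j hj]
  have hupper : x.ofLp ⬝ᵥ B *ᵥ x.ofLp ≤ sortedEigenvalues hB k * ‖x‖ ^ 2 := by
    rw [dotProduct_mulVec_eq_sum_sortedEigenvalues hB, ← c.sum_sq_inner_right x, Finset.mul_sum]
    refine Finset.sum_le_sum fun j _ => ?_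
    rcases le_or_gt k j with hj | hj
    · exact mul_le_mul_of_nonneg_right (sortedEigenvalues_antitone hB hj) (sq_nonneg _)
    · simp [c, hc j hj]
  exact le_of_mul_le_mul_right (hlower.trans ((hAB x.ofLp).trans hupper)) (by positivity)

/-- The Dirichlet form of a symmetric row-stochastic matrix. -/
theorem two_mul_dotProduct_mulVec_of_row_sum_eq_one {n : ℕ} {A : Matrix (Fin n) (Fin n) ℝ}
    (hA : A.IsHermitian) (hrow : ∀ i, ∑ j, A i j = 1) (x : Fin n → ℝ) :
    2 * (x ⬝ᵥ A *ᵥ x) = 2 * (x ⬝ᵥ x) - ∑ i, ∑ j, A i j * (x i - x j) ^ 2 := by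
  have hrows : ∑ i, ∑ j, A i j * x i ^ 2 = x ⬝ᵥ x := by
    simp_rw [← Finset.sum_mul, hrow, dotProduct]
    exact Finset.sum_congr rfl fun i _ => by ring
  have hcols : ∑ i, ∑ j, A i j * x j ^ 2 = x ⬝ᵥ x := by
    rw [Finset.sum_comm, ← hrows]
    refine Finset.sum_congr rfl fun i _ => Finset.sum_congr rfl fun j _ => ?_
    rw [← hA.apply i j, star_trivial]
  have hcross : ∑ i, ∑ j, A i j * (x i * x j) = x ⬝ᵥ A *ᵥ x := by
    simp_rw [dotProduct, Matrix.mulVec, dotProduct, Finset.mul_sum]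
    exact Finset.sum_congr rfl fun i _ => Finset.sum_congr rfl fun j _ => by ring
  have hexpand (i j : Fin n) : A i j * (x i - x j) ^ 2 =
      A i j * x i ^ 2 + A i j * x j ^ 2 - 2 * (A i j * (x i * x j)) := by ring
  simp_rw [hexpand, Finset.sum_sub_distrib, Finset.sum_add_distrib, ← Finset.mul_sum]
  rw [hrows, hcols, hcross]
  ring

theorem dotProduct_mulVec_le_of_offDiag_le {n : ℕ} {A B : Matrix (Fin n) (Fin n) ℝ}
    (hA : A.IsHermitian) (hB : B.IsHermitian)
    (hArow : ∀ i, ∑ j, A i j = 1) (hBrow : ∀ i, ∑ j, B i j = 1)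
    (hoff : ∀ i j, i ≠ j → B i j ≤ A i j) (x : Fin n → ℝ) :
    x ⬝ᵥ A *ᵥ x ≤ x ⬝ᵥ B *ᵥ x := by
  have hle : ∑ i, ∑ j, B i j * (x i - x j) ^ 2 ≤ ∑ i, ∑ j, A i j * (x i - x j) ^ 2 := by
    refine Finset.sum_le_sum fun i _ => Finset.sum_le_sum fun j _ => ?_
    rcases eq_or_ne i j with rfl | hij
    · simp
    · exact mul_le_mul_of_nonneg_right (hoff i j hij) (sq_nonneg _)
  linarith [two_mul_dotProduct_mulVec_of_row_sum_eq_one hA hArow x,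
    two_mul_dotProduct_mulVec_of_row_sum_eq_one hB hBrow x]

/-- Gershgorin's theorem for a row-stochastic matrix with diagonal at least `1 / 2`. -/
theorem sortedEigenvalues_mem_Icc {n : ℕ} {A : Matrix (Fin n) (Fin n) ℝ}
    (hA : A.IsHermitian) (hnonneg : ∀ i j, 0 ≤ A i j) (hrow : ∀ i, ∑ j, A i j = 1)
    (hdiag : ∀ i, (1 : ℝ) / 2 ≤ A i i) (k : Fin n) :
    sortedEigenvalues hA k ∈ Set.Icc (0 : ℝ) 1 := by
  obtain ⟨i, hi⟩ := eigenvalue_mem_ball (hasEigenvalue_sortedEigenvalues hA k)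
  have hradius : ∑ j ∈ Finset.univ.erase i, ‖A i j‖ = 1 - A i i := by
    simp_rw [Real.norm_of_nonneg (hnonneg _ _)]
    rw [← hrow i, ← Finset.add_sum_erase _ _ (Finset.mem_univ i)]
    ring
  rw [hradius, Metric.mem_closedBall, Real.dist_eq, abs_le] at hi
  constructor <;> linarith [hi.1, hi.2, hdiag i]

theorem sortedEigenvalues_zero_eq_one {n : ℕ} (hn : 0 < n) {A : Matrix (Fin n) (Fin n) ℝ}
    (hA : A.IsHermitian) (hrow : ∀ i, ∑ j, A i j = 1)
    (hle : ∀ k, sortedEigenvalues hA k ≤ 1) :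
    sortedEigenvalues hA ⟨0, hn⟩ = 1 := by
  have hone : Module.End.HasEigenvalue (Matrix.toLin' A) 1 := by
    refine Module.End.hasEigenvalue_of_hasEigenvector (x := 1) ⟨?_, fun h => ?_⟩
    · rw [Module.End.mem_eigenspace_iff]
      ext i
      simpa [Matrix.mulVec, dotProduct] using hrow i
    · simpa using congrFun h ⟨0, hn⟩
  obtain ⟨k, hk⟩ := exists_sortedEigenvalues_eq hA hone
  exact le_antisymm (hle _) (hk ▸ sortedEigenvalues_antitone hA (Nat.zero_le k.1))

/-- Confirmation bias weakly increases the second largest eigenvalue modulus: if `T`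
and `T*` are symmetric row-stochastic with `T i i ≥ 1/2`, off-diagonal entries of `T*`
weakly below those of `T`, and equal row sums, then all eigenvalues of both lie in
`[0,1]`, the top eigenvalue of each is `1`, and `λ₂(T*) ≥ λ₂(T)`; in particular the
second largest eigenvalue modulus of `T*` is at least that of `T`. -/
theorem slem_mono_of_confirmation_bias {n : ℕ} (hn : 2 ≤ n)
    (T Tstar : Matrix (Fin n) (Fin n) ℝ)
    (hT : T.IsHermitian) (hTstar : Tstar.IsHermitian)
    (hTnonneg : ∀ i j, 0 ≤ T i j) (hTrow : ∀ i, ∑ j, T i j = 1)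
    (hTstarnonneg : ∀ i j, 0 ≤ Tstar i j) (hTstarrow : ∀ i, ∑ j, Tstar i j = 1)
    (hdiag : ∀ i, (1 : ℝ) / 2 ≤ T i i)
    (hoff : ∀ i j, i ≠ j → Tstar i j ≤ T i j) :
    (∀ k, sortedEigenvalues hT k ∈ Set.Icc (0 : ℝ) 1) ∧
    (∀ k, sortedEigenvalues hTstar k ∈ Set.Icc (0 : ℝ) 1) ∧
    sortedEigenvalues hT ⟨0, by omega⟩ = 1 ∧
    sortedEigenvalues hTstar ⟨0, by omega⟩ = 1 ∧
    sortedEigenvalues hT ⟨1, hn⟩ ≤ sortedEigenvalues hTstar ⟨1, hn⟩ ∧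
    |sortedEigenvalues hT ⟨1, hn⟩| ≤ |sortedEigenvalues hTstar ⟨1, hn⟩| := by
  have hdiagstar (i : Fin n) : (1 : ℝ) / 2 ≤ Tstar i i := by
    have hsum : ∑ j ∈ Finset.univ.erase i, Tstar i j ≤ ∑ j ∈ Finset.univ.erase i, T i j :=
      Finset.sum_le_sum fun j hj => hoff i j (Finset.ne_of_mem_erase hj).symm
    have hrow := hTrow i
    have hrowstar := hTstarrow i
    rw [← Finset.add_sum_erase _ _ (Finset.mem_univ i)] at hrow hrowstar
    linarith [hdiag i]
  have hIcc := sortedEigenvalues_mem_Icc hT hTnonneg hTrow hdiag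
  have hIccstar := sortedEigenvalues_mem_Icc hTstar hTstarnonneg hTstarrow hdiagstar
  have hmono := sortedEigenvalues_mono hT hTstar
    (dotProduct_mulVec_le_of_offDiag_le hT hTstar hTrow hTstarrow hoff) ⟨1, hn⟩
  exact ⟨hIcc, hIccstar,
    sortedEigenvalues_zero_eq_one _ hT hTrow fun k => (hIcc k).2,
    sortedEigenvalues_zero_eq_one _ hTstar hTstarrow fun k => (hIccstar k).2,
    hmono, abs_le_abs_of_nonneg (hIcc _).1 hmono⟩
end
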